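/- Suppose Φ(r, ·) is differentiable and concave (not necessarily strictly) on 𝓐 for every r ∈ 𝓡, E[f(R)] = ᾱ, G_f is measurable and non-decreasing, and Φ(R, f(R)), Φ(R, ᾱ), G_f(R), and G_f(R)·f(R) are all integrable. Then the adaptive allocation weakly improves expected utility: E[Φ(R, f(R))] ≥ E[Φ(R, ᾱ)]. -/

import Mathlib

open MeasureTheory Set

/-- A concave function lies below its tangent lines. -/
theorem ConcaveOn.deriv_mul_sub_le_sub {s : Set ℝ} {g : ℝ → ℝ} (hg : ConcaveOn ℝ s g)
    {x y : ℝ} (hx : x ∈ s) (hy : y ∈ s) (hd : DifferentiableAt ℝ g x) :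
    deriv g x * (x - y) ≤ g x - g y := by
  rcases lt_trichotomy x y with h | rfl | h
  · have hs := hg.slope_le_deriv hx hy h hd
    rw [slope_def_field, div_le_iff₀ (sub_pos.2 h)] at hs
    linarith
  · simp
  · have hs := hg.deriv_le_slope hy hx h hd
    rwa [slope_def_field, le_div_iff₀ (sub_pos.2 h)] at hs

/-- **Chebyshev's association inequality**: random variables that vary together are nonnegatively
correlated. -/
theorem Monovary.integral_mul_integral_le {Ω : Type*} [MeasurableSpace Ω] {μ : Measure Ω}
    [IsProbabilityMeasure μ] {X Y : Ω → ℝ} (h : Monovary X Y) (hX : Integrable X μ)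
    (hY : Integrable Y μ) (hXY : Integrable (fun ω => X ω * Y ω) μ) :
    (∫ ω, X ω ∂μ) * ∫ ω, Y ω ∂μ ≤ ∫ ω, X ω * Y ω ∂μ := by
  have key (ω' : Ω) : X ω' * (∫ ω, Y ω ∂μ) + (∫ ω, X ω ∂μ) * Y ω' ≤
      (∫ ω, X ω * Y ω ∂μ) + X ω' * Y ω' := by
    have hle := integral_mono (μ := μ) ((hY.const_mul (X ω')).add (hX.mul_const (Y ω')))
      (hXY.add (integrable_const (X ω' * Y ω'))) fun ω => by
        have := monovary_iff_forall_mul_nonneg.1 h ω ω'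
        simp only [Pi.add_apply]
        linarith
    simp only [Pi.add_apply] at hle
    rwa [integral_add (hY.const_mul _) (hX.mul_const _), integral_add hXY (integrable_const _),
      integral_const_mul, integral_mul_const, integral_const, probReal_univ, one_smul] at hle
  have hle := integral_mono (μ := μ)
    ((hX.mul_const (∫ ω, Y ω ∂μ)).add (hY.const_mul (∫ ω, X ω ∂μ)))
    ((integrable_const (∫ ω, X ω * Y ω ∂μ)).add hXY) key
  simp only [Pi.add_apply] at hle
  rw [integral_add (hX.mul_const _) (hY.const_mul _), integral_add (integrable_const _) hXY,
    integral_const_mul, integral_mul_const, integral_const, probReal_univ, one_smul] at hle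
  linarith

/-- **Weak utility gain under (non-strict) concavity.** If `Φ(r, ·)` is
differentiable and concave on `𝒜` for every `r ∈ 𝓡`, `E[f(R)] = ᾱ`, and `G_f`
is measurable and non-decreasing, then `E[Φ(R, f(R))] ≥ E[Φ(R, ᾱ)]`. -/
theorem adaptive_allocation_weak_utility_gain
    {Ω : Type*} [MeasurableSpace Ω] (μ : Measure Ω) [IsProbabilityMeasure μ]
    (R : Ω → ℝ) (hRmeas : Measurable R)
    (𝓡 : Set ℝ) (hsupp : ∀ ω, R ω ∈ 𝓡)
    (a b ᾱ : ℝ) (hᾱpos : 0 < ᾱ)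
    (hApos : Ioo a b ⊆ Ioi (0 : ℝ)) (hᾱA : ᾱ ∈ Ioo a b)
    (Φ : ℝ → ℝ → ℝ)
    (hΦmeas : ∀ α ∈ Ioo a b, Measurable fun r => Φ r α)
    (hΦdiff : ∀ r ∈ 𝓡, ∀ α ∈ Ioo a b, DifferentiableAt ℝ (Φ r) α)
    (hΦconc : ∀ r ∈ 𝓡, ConcaveOn ℝ (Ioo a b) (Φ r))
    (f : ℝ → ℝ) (hfmeas : Measurable f) (hfmono : MonotoneOn f 𝓡)
    (hfmaps : ∀ r ∈ 𝓡, f r ∈ Ioo a b)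
    (Gf : ℝ → ℝ) (hGf : ∀ r ∈ 𝓡, Gf r = deriv (Φ r) (f r))
    (hfint : Integrable (fun ω => f (R ω)) μ)
    (hbudget : ∫ ω, f (R ω) ∂μ = ᾱ)
    (hGfmeas : Measurable Gf) (hGfmono : MonotoneOn Gf 𝓡)
    (hint1 : Integrable (fun ω => Φ (R ω) (f (R ω))) μ)
    (hint2 : Integrable (fun ω => Φ (R ω) ᾱ) μ)
    (hint3 : Integrable (fun ω => Gf (R ω)) μ)
    (hint4 : Integrable (fun ω => Gf (R ω) * f (R ω)) μ) :
    ∫ ω, Φ (R ω) ᾱ ∂μ ≤ ∫ ω, Φ (R ω) (f (R ω)) ∂μ := by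
  have hvary : Monovary (fun ω => Gf (R ω)) (fun ω => f (R ω)) := fun ω ω' hlt =>
    hGfmono (hsupp ω) (hsupp ω') (hfmono.reflect_lt (hsupp ω) (hsupp ω') hlt).le
  have hcheb := hvary.integral_mul_integral_le hint3 hfint hint4
  rw [hbudget] at hcheb
  have hle := integral_mono (μ := μ) (hint4.sub (hint3.mul_const ᾱ)) (hint1.sub hint2) fun ω => by
    have := (hΦconc _ (hsupp ω)).deriv_mul_sub_le_sub (hfmaps _ (hsupp ω)) hᾱA
      (hΦdiff _ (hsupp ω) _ (hfmaps _ (hsupp ω)))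
    rw [← hGf _ (hsupp ω)] at this
    simp only [Pi.sub_apply]
    linarith
  simp only [Pi.sub_apply] at hle
  rw [integral_sub hint4 (hint3.mul_const _), integral_sub hint1 hint2, integral_mul_const] at hle
  linarith
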